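/- arXiv:1602.03595 — 6 statements merged into one kernel-verified Lean document; each statement's English description precedes it below -/
import Mathlib

section
/- (Lemma relating the logical rules to reductions.) Suppose the following is an instance of rule (+,+), (⊕,+), or (+,⊕): from premises Γ, ρ ⊣ σ ▷ ρ_1 ⊣ σ_1, …, Γ, ρ ⊣ σ ▷ ρ_n ⊣ σ_n conclude Γ ▷ ρ ⊣ σ. Then for all histories δ⃗, γ⃗ and for each i = 1, …, n there exist histories δ⃗_i, γ⃗_i such that ⟨δ⃗⟩ρ ∥ ⟨γ⃗⟩σ →* ⟨δ⃗_i⟩ρ_i ∥ ⟨γ⃗_i⟩σ_i by a reduction sequence in which rule (rbk) is never used (no rollback occurs). -/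
/-! Retractable contracts (Barbanera, Dezani-Ciancaglini, Lanese, de'Liguoro,
"Retractable Contracts"). -/

/-- Retractable contract expressions, with de Bruijn indices for recursion.
`ext true l` is a retractable input sum `Σ aᵢ.σᵢ`, `ext false l` a retractable
output sum `Σ āᵢ.σᵢ`, and `intSum l` an unretractable output choice `⊕ āᵢ.σᵢ`. -/
inductive RC : Type
  | one : RC
  | ext : Bool → List (ℕ × RC) → RC
  | intSum : List (ℕ × RC) → RC
  | var : ℕ → RC
  | mu : RC → RC

namespace RC

/-- Substitution of the (closed) term `u` for variable `k`. -/
def subst (t : RC) (k : ℕ) (u : RC) : RC :=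
  match t with
  | .one => .one
  | .var n => if n = k then u else .var n
  | .mu σ => .mu (subst σ (k+1) u)
  | .ext p l => .ext p (l.attach.map fun x => (x.1.1, subst x.1.2 k u))
  | .intSum l => .intSum (l.attach.map fun x => (x.1.1, subst x.1.2 k u))
termination_by sizeOf t
decreasing_by
  all_goals simp_wf
  all_goals first
    | omega
    | (obtain ⟨⟨a, s⟩, hx⟩ := x
       have h := List.sizeOf_lt_of_mem hx
       simp [Prod.mk.sizeOf_spec] at h ⊢
       omega)

/-- One-step unfolding of the recursive contract `mu σ`
(`rec x.σ` is equated with `σ[rec x.σ / x]`). -/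
def unf (σ : RC) : RC := subst σ 0 (.mu σ)

/-- Well-formedness: `WFa n σ` means all free variables of `σ` are below `n`,
all sums are non-empty with pairwise distinct names, and recursion is guarded
(the body of a recursion is not a variable). -/
inductive WFa : ℕ → RC → Prop
  | one : ∀ n, WFa n .one
  | var : ∀ n m, m < n → WFa n (.var m)
  | ext : ∀ (n : ℕ) (p : Bool) (l : List (ℕ × RC)), l ≠ [] → (l.map Prod.fst).Nodup →
      (∀ x ∈ l, WFa n x.2) → WFa n (.ext p l)
  | intSum : ∀ (n : ℕ) (l : List (ℕ × RC)), l ≠ [] → (l.map Prod.fst).Nodup →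
      (∀ x ∈ l, WFa n x.2) → WFa n (.intSum l)
  | mu : ∀ (n : ℕ) (σ : RC), (∀ m, σ ≠ .var m) → WFa (n+1) σ → WFa n (.mu σ)

end RC

/-- A retractable contract: a closed well-formed expression. -/
def WF (σ : RC) : Prop := RC.WFa 0 σ

/-- Head unfolding: `Unf ρ τ` holds when repeatedly unfolding top-level
recursion in `ρ` yields `τ` (equi-recursive view of recursion). -/
inductive Unf : RC → RC → Prop
  | one : Unf .one .one
  | ext : ∀ p l, Unf (.ext p l) (.ext p l)
  | intSum : ∀ l, Unf (.intSum l) (.intSum l)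
  | var : ∀ n, Unf (.var n) (.var n)
  | mu : ∀ σ τ, Unf (RC.unf σ) τ → Unf (.mu σ) τ

/-- Actions of the LTS: `act true a` is the input `a`, `act false a` is the
output `ā`; `tau` is the internal action; `rb` is rollback. -/
inductive Act : Type
  | act : Bool → ℕ → Act
  | tau : Act
  | rb : Act

/-- Histories (stacks); the head of the list is the top of the stack.
`none` is the placeholder `∘` (no remaining alternatives). -/
abbrev Hist := List (Option RC)

/-- The sum of the remaining branches of a retractable sum, or `∘` if no
branch remains. -/
def restOf (p : Bool) (l : List (ℕ × RC)) : Option RC :=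
  match l with
  | [] => none
  | _ => some (.ext p l)

/-- LTS of contracts with histories: rules (+)/(α) (`ext`, `intOut`), (⊕)
(`intTau`), (rb) (`rb`), plus transparent unfolding of recursion (`mu`). -/
inductive Step : Hist → Option RC → Act → Hist → Option RC → Prop
  | ext : ∀ (γ : Hist) (p : Bool) (l₁ l₂ : List (ℕ × RC)) (a : ℕ) (σ : RC),
      Step γ (some (.ext p (l₁ ++ (a, σ) :: l₂))) (.act p a)
        (restOf p (l₁ ++ l₂) :: γ) (some σ)
  | intTau : ∀ (γ : Hist) (l : List (ℕ × RC)) (a : ℕ) (σ : RC),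
      (a, σ) ∈ l → 2 ≤ l.length →
      Step γ (some (.intSum l)) .tau γ (some (.intSum [(a, σ)]))
  | intOut : ∀ (γ : Hist) (a : ℕ) (σ : RC),
      Step γ (some (.intSum [(a, σ)])) (.act false a) (none :: γ) (some σ)
  | rb : ∀ (γ : Hist) (σ' ρ : Option RC),
      Step (σ' :: γ) ρ .rb γ σ'
  | mu : ∀ (γ : Hist) (σ : RC) (α : Act) (δ : Hist) (ρ : Option RC),
      Step γ (some (RC.unf σ)) α δ ρ → Step γ (some (.mu σ)) α δ ρ

/-- Client/server configurations `⟨cH⟩c ∥ ⟨sH⟩s`. -/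
structure Conf : Type where
  cH : Hist
  c  : Option RC
  sH : Hist
  s  : Option RC

/-- Forward reduction of client/server pairs: rules (comm) and (τ). -/
inductive FRed : Conf → Conf → Prop
  | comm : ∀ (δ δ' γ γ' : Hist) (ρ ρ' σ σ' : Option RC) (p : Bool) (a : ℕ),
      Step δ ρ (.act p a) δ' ρ' → Step γ σ (.act (!p) a) γ' σ' →
      FRed ⟨δ, ρ, γ, σ⟩ ⟨δ', ρ', γ', σ'⟩
  | tauL : ∀ (δ δ' γ : Hist) (ρ ρ' σ : Option RC),
      Step δ ρ .tau δ' ρ' → FRed ⟨δ, ρ, γ, σ⟩ ⟨δ', ρ', γ, σ⟩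
  | tauR : ∀ (δ γ γ' : Hist) (ρ σ σ' : Option RC),
      Step γ σ .tau γ' σ' → FRed ⟨δ, ρ, γ, σ⟩ ⟨δ, ρ, γ', σ'⟩

/-- Reduction of client/server pairs: forward steps, plus the rule (rbk),
applicable only when the client is not `1` and no forward step is possible. -/
inductive Red : Conf → Conf → Prop
  | fwd : ∀ c c', FRed c c' → Red c c'
  | rbk : ∀ (δ δ' γ γ' : Hist) (ρ ρ' σ σ' : Option RC),
      ρ ≠ some .one → (∀ d, ¬ FRed ⟨δ, ρ, γ, σ⟩ d) →
      Step δ ρ .rb δ' ρ' → Step γ σ .rb γ' σ' →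
      Red ⟨δ, ρ, γ, σ⟩ ⟨δ', ρ', γ', σ'⟩

/-- Multi-step reduction of client/server pairs. -/
def Reds : Conf → Conf → Prop := Relation.ReflTransGen Red

/-- A configuration admitting no reduction. -/
def Stuck (c : Conf) : Prop := ∀ c', ¬ Red c c'

/-- A rollback step of a client/server pair (an instance of rule (rbk)). -/
def RbkStep (c c' : Conf) : Prop :=
  c.c ≠ some RC.one ∧ (∀ d, ¬ FRed c d) ∧
  Step c.cH c.c .rb c'.cH c'.c ∧ Step c.sH c.s .rb c'.sH c'.s

/-- Compliance of contracts with histories: every reachable stuck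
configuration has client `1`. -/
def CompliantCH (δ : Hist) (ρ : Option RC) (γ : Hist) (σ : Option RC) : Prop :=
  ∀ c' : Conf, Reds ⟨δ, ρ, γ, σ⟩ c' → Stuck c' → c'.c = some RC.one

/-- Compliance of contracts: `ρ ⫤ σ`. -/
def Compliant (ρ σ : RC) : Prop := CompliantCH [] (some ρ) [] (some σ)

/-- The formal system for compliance: `Derives Γ ρ σ` is the judgment
`Γ ▷ ρ ⊣ σ`, with rules (Ax), (Hyp), (+,+), (⊕,+), (+,⊕), and rules
realising the equi-recursive identification `rec x.σ = σ[rec x.σ/x]`. -/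
inductive Derives : List (RC × RC) → RC → RC → Prop
  | ax : ∀ Γ σ, Derives Γ .one σ
  | hyp : ∀ Γ ρ σ, (ρ, σ) ∈ Γ → Derives Γ ρ σ
  | plusPlus : ∀ (Γ : List (RC × RC)) (p : Bool) (lρ lσ : List (ℕ × RC)) (a : ℕ) (ρk σk : RC),
      (a, ρk) ∈ lρ → (a, σk) ∈ lσ →
      Derives ((RC.ext p lρ, RC.ext (!p) lσ) :: Γ) ρk σk →
      Derives Γ (.ext p lρ) (.ext (!p) lσ)
  | oplusPlus : ∀ (Γ : List (RC × RC)) (lρ lσ : List (ℕ × RC)),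
      (∀ x ∈ lρ, x.1 ∈ lσ.map Prod.fst) →
      (∀ (a : ℕ) (ρi σi : RC), (a, ρi) ∈ lρ → (a, σi) ∈ lσ →
        Derives ((RC.intSum lρ, RC.ext true lσ) :: Γ) ρi σi) →
      Derives Γ (.intSum lρ) (.ext true lσ)
  | plusOplus : ∀ (Γ : List (RC × RC)) (lρ lσ : List (ℕ × RC)),
      (∀ x ∈ lσ, x.1 ∈ lρ.map Prod.fst) →
      (∀ (a : ℕ) (ρj σj : RC), (a, ρj) ∈ lρ → (a, σj) ∈ lσ →
        Derives ((RC.ext true lρ, RC.intSum lσ) :: Γ) ρj σj) →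
      Derives Γ (.ext true lρ) (.intSum lσ)
  | unfoldL : ∀ (Γ : List (RC × RC)) (σ τ : RC),
      Derives Γ (RC.unf σ) τ → Derives Γ (.mu σ) τ
  | unfoldR : ∀ (Γ : List (RC × RC)) (ρ σ : RC),
      Derives Γ ρ (RC.unf σ) → Derives Γ ρ (.mu σ)

theorem Step.ext_of_mem (γ : Hist) (p : Bool) {l : List (ℕ × RC)} {a : ℕ} {σ : RC}
    (h : (a, σ) ∈ l) : ∃ γ', Step γ (some (.ext p l)) (.act p a) γ' (some σ) := by
  obtain ⟨l₁, l₂, rfl⟩ := List.append_of_mem h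
  exact ⟨_, .ext γ p l₁ l₂ a σ⟩

/-- An unretractable choice either already is the chosen branch or commits to it silently. -/
theorem Step.intSum_commit (γ : Hist) {l : List (ℕ × RC)} {a : ℕ} {σ : RC} (h : (a, σ) ∈ l) :
    l = [(a, σ)] ∨ Step γ (some (.intSum l)) .tau γ (some (.intSum [(a, σ)])) := by
  match l, h with
  | [x], h => exact .inl (by rw [List.mem_singleton.mp h])
  | x :: y :: t, h => exact .inr (.intTau _ _ _ _ h (by simp))

/-- for every instance of rule (+,+), (⊕,+) or (+,⊕), each premise
pair of contracts is reachable from the conclusion pair, for arbitrary initial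
histories, by a reduction sequence that never uses rule (rbk) (i.e. a sequence
of forward (comm)/(τ) steps). -/
theorem premises_reachable_without_rollback :
    (∀ (Γ : List (RC × RC)) (p : Bool) (lρ lσ : List (ℕ × RC)) (a : ℕ) (ρk σk : RC),
        (a, ρk) ∈ lρ → (a, σk) ∈ lσ →
        Derives ((RC.ext p lρ, RC.ext (!p) lσ) :: Γ) ρk σk →
        ∀ δ γ : Hist, ∃ δ' γ' : Hist,
          Relation.ReflTransGen FRed
            ⟨δ, some (.ext p lρ), γ, some (.ext (!p) lσ)⟩
            ⟨δ', some ρk, γ', some σk⟩) ∧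
    (∀ (Γ : List (RC × RC)) (lρ lσ : List (ℕ × RC)) (a : ℕ) (ρi σi : RC),
        (a, ρi) ∈ lρ → (a, σi) ∈ lσ →
        Derives ((RC.intSum lρ, RC.ext true lσ) :: Γ) ρi σi →
        ∀ δ γ : Hist, ∃ δ' γ' : Hist,
          Relation.ReflTransGen FRed
            ⟨δ, some (.intSum lρ), γ, some (.ext true lσ)⟩
            ⟨δ', some ρi, γ', some σi⟩) ∧
    (∀ (Γ : List (RC × RC)) (lρ lσ : List (ℕ × RC)) (a : ℕ) (ρj σj : RC),
        (a, ρj) ∈ lρ → (a, σj) ∈ lσ →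
        Derives ((RC.ext true lρ, RC.intSum lσ) :: Γ) ρj σj →
        ∀ δ γ : Hist, ∃ δ' γ' : Hist,
          Relation.ReflTransGen FRed
            ⟨δ, some (.ext true lρ), γ, some (.intSum lσ)⟩
            ⟨δ', some ρj, γ', some σj⟩) := by
  refine ⟨?_, ?_, ?_⟩
  · intro _ p _ _ a _ _ hρ hσ _ δ γ
    obtain ⟨δ', hδ⟩ := Step.ext_of_mem δ p hρ
    obtain ⟨γ', hγ⟩ := Step.ext_of_mem γ (!p) hσ
    exact ⟨δ', γ', .single (.comm _ _ _ _ _ _ _ _ p a hδ hγ)⟩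
  · intro _ _ _ a ρi _ hρ hσ _ δ γ
    obtain ⟨γ', hγ⟩ := Step.ext_of_mem γ true hσ
    have comm := FRed.comm _ _ _ _ _ _ _ _ false a (.intOut δ a ρi) hγ
    refine ⟨none :: δ, γ', ?_⟩
    rcases Step.intSum_commit δ hρ with rfl | hτ
    · exact .single comm
    · exact .head (.tauL _ _ _ _ _ _ hτ) (.single comm)
  · intro _ _ _ a _ σj hρ hσ _ δ γ
    obtain ⟨δ', hδ⟩ := Step.ext_of_mem δ true hρ
    have comm := FRed.comm _ _ _ _ _ _ _ _ true a hδ (.intOut γ a σj)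
    refine ⟨δ', none :: γ, ?_⟩
    rcases Step.intSum_commit γ hσ with rfl | hτ
    · exact .single comm
    · exact .head (.tauR _ _ _ _ _ _ hτ) (.single comm)
end

section
/- (Key underivability step in the soundness proof.) If the judgments ▷ ρ'' ⊣ σ'' and ▷ ρ_k ⊣ σ_k are both underivable in the formal system (with empty set of hypotheses), then the judgment ▷ a.ρ_k + ρ'' ⊣ ā.σ_k + σ'' is underivable as well, provided that ⟨[]⟩(a.ρ_k + ρ'') is not compliant with ⟨[]⟩(ā.σ_k + σ''). -/
theorem Derives.weaken {Γ : List (RC × RC)} {ρ σ : RC} (h : Derives Γ ρ σ) :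
    ∀ {Δ : List (RC × RC)}, Γ ⊆ Δ → Derives Δ ρ σ := by
  induction h with
  | ax Γ σ => exact fun _ => .ax _ _
  | hyp Γ ρ σ hm => exact fun hs => .hyp _ _ _ (hs hm)
  | plusPlus Γ p lρ lσ a ρk σk h₁ h₂ _ ih =>
    exact fun hs => .plusPlus _ p lρ lσ a ρk σk h₁ h₂ (ih (List.cons_subset_cons _ hs))
  | oplusPlus Γ lρ lσ hn _ ih =>
    exact fun hs => .oplusPlus _ lρ lσ hn fun a ρi σi h₁ h₂ =>
      ih a ρi σi h₁ h₂ (List.cons_subset_cons _ hs)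
  | plusOplus Γ lρ lσ hn _ ih =>
    exact fun hs => .plusOplus _ lρ lσ hn fun a ρj σj h₁ h₂ =>
      ih a ρj σj h₁ h₂ (List.cons_subset_cons _ hs)
  | unfoldL Γ σ τ _ ih => exact fun hs => .unfoldL _ _ _ (ih hs)
  | unfoldR Γ ρ σ _ ih => exact fun hs => .unfoldR _ _ _ (ih hs)

theorem Derives.forall_mem_cons {Γ Δ : List (RC × RC)} (y : RC × RC)
    (h : ∀ x ∈ Γ, Derives Δ x.1 x.2) : ∀ x ∈ y :: Γ, Derives (y :: Δ) x.1 x.2 := by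
  intro x hx
  rcases List.mem_cons.1 hx with rfl | hx
  · exact .hyp _ _ _ List.mem_cons_self
  · exact (h x hx).weaken (List.subset_cons_self _ _)

/-- Simultaneous cut: hypotheses that are derivable from `Δ` can be replaced by `Δ`. -/
theorem Derives.cut {Γ : List (RC × RC)} {ρ σ : RC} (h : Derives Γ ρ σ) :
    ∀ {Δ : List (RC × RC)}, (∀ x ∈ Γ, Derives Δ x.1 x.2) → Derives Δ ρ σ := by
  induction h with
  | ax Γ σ => exact fun _ => .ax _ _
  | hyp Γ ρ σ hm => exact fun hs => hs _ hm
  | plusPlus Γ p lρ lσ a ρk σk h₁ h₂ _ ih =>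
    exact fun hs => .plusPlus _ p lρ lσ a ρk σk h₁ h₂ (ih (forall_mem_cons _ hs))
  | oplusPlus Γ lρ lσ hn _ ih =>
    exact fun hs => .oplusPlus _ lρ lσ hn fun a ρi σi h₁ h₂ =>
      ih a ρi σi h₁ h₂ (forall_mem_cons _ hs)
  | plusOplus Γ lρ lσ hn _ ih =>
    exact fun hs => .plusOplus _ lρ lσ hn fun a ρj σj h₁ h₂ =>
      ih a ρj σj h₁ h₂ (forall_mem_cons _ hs)
  | unfoldL Γ σ τ _ ih => exact fun hs => .unfoldL _ _ _ (ih hs)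
  | unfoldR Γ ρ σ _ ih => exact fun hs => .unfoldR _ _ _ (ih hs)

/-- A derivable pair of dual retractable sums has a common branch whose
continuations are derivable without hypotheses. -/
theorem Derives.exists_branch {p q : Bool} {lρ lσ : List (ℕ × RC)}
    (h : Derives [] (.ext p lρ) (.ext q lσ)) :
    ∃ a ρ σ, (a, ρ) ∈ lρ ∧ (a, σ) ∈ lσ ∧ Derives [] ρ σ := by
  have hAB := h
  cases h with
  | hyp _ _ _ hm => cases hm
  | plusPlus _ _ _ _ a ρ σ h₁ h₂ hd =>
    refine ⟨a, ρ, σ, h₁, h₂, hd.cut fun x hx => ?_⟩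
    rw [List.mem_singleton.1 hx]
    exact hAB

/-- In a well-formed sum, the branches other than the first have other names. -/
theorem RC.WFa.ne_of_mem_tail {n : ℕ} {p : Bool} {a b : ℕ} {ρ τ : RC} {l : List (ℕ × RC)}
    (h : RC.WFa n (.ext p ((a, ρ) :: l))) (hm : (b, τ) ∈ l) : b ≠ a := by
  cases h with
  | ext _ _ _ _ hnd _ =>
    rintro rfl
    exact (List.nodup_cons.1 hnd).1 (List.mem_map.2 ⟨_, hm, rfl⟩)

/-- Key underivability step: if `▷ ρ'' ⊣ σ''` and `▷ ρk ⊣ σk`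
are underivable and `a.ρk + ρ''` is not compliant with `ā.σk + σ''`, then
`▷ a.ρk + ρ'' ⊣ ā.σk + σ''` is underivable.  Here the client is the
retractable sum `ext p ((a,ρk) :: l₁)` (so `ρ'' = ext p l₁`) and the server is
the dual retractable sum `ext (!p) ((a,σk) :: l₂)` (so `σ'' = ext (!p) l₂`). -/
theorem key_underivability (p : Bool) (a : ℕ) (ρk σk : RC)
    (l₁ l₂ : List (ℕ × RC))
    (hwfρ : WF (.ext p ((a, ρk) :: l₁))) (hwfσ : WF (.ext (!p) ((a, σk) :: l₂)))
    (h1 : ¬ Derives [] (.ext p l₁) (.ext (!p) l₂))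
    (h2 : ¬ Derives [] ρk σk)
    (h3 : ¬ CompliantCH [] (some (.ext p ((a, ρk) :: l₁)))
                       [] (some (.ext (!p) ((a, σk) :: l₂)))) :
    ¬ Derives [] (.ext p ((a, ρk) :: l₁)) (.ext (!p) ((a, σk) :: l₂)) := by
  intro h
  obtain ⟨b, ρ, σ, hρ, hσ, hd⟩ := h.exists_branch
  rcases List.mem_cons.1 hρ with eρ | hρ <;> rcases List.mem_cons.1 hσ with eσ | hσ
  · obtain ⟨rfl, rfl⟩ := Prod.mk.inj eρ
    obtain ⟨-, rfl⟩ := Prod.mk.inj eσ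
    exact h2 hd
  · exact hwfσ.ne_of_mem_tail hσ (Prod.mk.inj eρ).1
  · exact hwfρ.ne_of_mem_tail hρ (Prod.mk.inj eσ).1
  · exact h1 (.plusPlus _ p l₁ l₂ b ρ σ hρ hσ (hd.weaken (List.nil_subset _)))
end

section
/- (Compliance is preserved by extending histories on the left.) If ⟨δ⃗⟩ρ ⫤ ⟨γ⃗⟩σ, then for all histories δ⃗' and γ⃗' the pair obtained by prepending them, ⟨δ⃗' : δ⃗⟩ρ ⫤ ⟨γ⃗' : γ⃗⟩σ, also holds (where δ⃗' : δ⃗ denotes concatenation of stacks with δ⃗' below δ⃗). -/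
theorem Step.append {γ γ₁ : Hist} {ρ ρ₁ : Option RC} {α : Act} (ε : Hist)
    (h : Step γ ρ α γ₁ ρ₁) : Step (γ ++ ε) ρ α (γ₁ ++ ε) ρ₁ := by
  induction h with
  | ext γ p l₁ l₂ a σ => exact .ext _ p l₁ l₂ a σ
  | intTau γ l a σ hmem hlen => exact .intTau _ l a σ hmem hlen
  | intOut γ a σ => exact .intOut _ a σ
  | rb γ σ' ρ => exact .rb _ σ' ρ
  | mu γ σ α δ ρ _ ih => exact .mu _ σ α _ ρ ih

theorem Step.of_append {γ ε γ₁ : Hist} {ρ ρ₁ : Option RC} {α : Act}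
    (h : Step (γ ++ ε) ρ α γ₁ ρ₁) (hα : α ≠ .rb) :
    ∃ γ₂, γ₁ = γ₂ ++ ε ∧ Step γ ρ α γ₂ ρ₁ := by
  generalize hη : γ ++ ε = η at h
  induction h with
  | ext η p l₁ l₂ a σ => exact ⟨_ :: γ, by simp [hη], .ext γ p l₁ l₂ a σ⟩
  | intTau η l a σ hmem hlen => exact ⟨γ, hη.symm, .intTau γ l a σ hmem hlen⟩
  | intOut η a σ => exact ⟨_ :: γ, by simp [hη], .intOut γ a σ⟩
  | rb => exact absurd rfl hα
  | mu η σ α δ ρ _ ih =>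
    obtain ⟨γ₂, h₁, h₂⟩ := ih hα hη
    exact ⟨γ₂, h₁, .mu γ σ α γ₂ ρ h₂⟩

theorem Step.eq_cons_of_rb {γ γ₁ : Hist} {ρ ρ₁ : Option RC}
    (h : Step γ ρ .rb γ₁ ρ₁) : γ = ρ₁ :: γ₁ := by
  generalize hα : Act.rb = α at h
  induction h with
  | rb => rfl
  | mu η σ α δ ρ _ ih => exact ih hα
  | _ => cases hα

/-- The configuration obtained by placing histories below the current ones. -/
def Conf.append (c : Conf) (δ γ : Hist) : Conf := ⟨c.cH ++ δ, c.c, c.sH ++ γ, c.s⟩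

theorem FRed.append {c d : Conf} (δ γ : Hist) (h : FRed c d) :
    FRed (c.append δ γ) (d.append δ γ) := by
  cases h with
  | comm _ _ _ _ _ _ _ _ p a h₁ h₂ =>
    exact .comm _ _ _ _ _ _ _ _ p a (h₁.append δ) (h₂.append γ)
  | tauL _ _ _ _ _ _ h => exact .tauL _ _ _ _ _ _ (h.append δ)
  | tauR _ _ _ _ _ _ h => exact .tauR _ _ _ _ _ _ (h.append γ)

theorem FRed.of_append {c d : Conf} {δ γ : Hist} (h : FRed (c.append δ γ) d) :
    ∃ e : Conf, d = e.append δ γ ∧ FRed c e := by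
  obtain ⟨cH, ρ, sH, σ⟩ := c
  cases h with
  | comm _ _ _ _ _ ρ' _ σ' p a h₁ h₂ =>
    obtain ⟨δ₁, rfl, h₃⟩ := h₁.of_append (by simp)
    obtain ⟨γ₁, rfl, h₄⟩ := h₂.of_append (by simp)
    exact ⟨⟨δ₁, ρ', γ₁, σ'⟩, rfl, .comm _ _ _ _ _ _ _ _ p a h₃ h₄⟩
  | tauL _ _ _ _ ρ' _ h =>
    obtain ⟨δ₁, rfl, h'⟩ := h.of_append (by simp)
    exact ⟨⟨δ₁, ρ', sH, σ⟩, rfl, .tauL _ _ _ _ _ _ h'⟩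
  | tauR _ _ _ _ _ σ' h =>
    obtain ⟨γ₁, rfl, h'⟩ := h.of_append (by simp)
    exact ⟨⟨cH, ρ, γ₁, σ'⟩, rfl, .tauR _ _ _ _ _ _ h'⟩

theorem Red.append {c d : Conf} (δ γ : Hist) (h : Red c d) :
    Red (c.append δ γ) (d.append δ γ) := by
  cases h with
  | fwd _ _ h => exact .fwd _ _ (h.append δ γ)
  | rbk δ₁ _ γ₁ _ ρ _ σ _ hρ hF h₁ h₂ =>
    refine .rbk _ _ _ _ _ _ _ _ hρ (fun d hd => ?_) (h₁.append δ) (h₂.append γ)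
    obtain ⟨e, -, he⟩ := FRed.of_append (c := ⟨δ₁, ρ, γ₁, σ⟩) hd
    exact hF e he

/-- A reduction above extended histories comes from a reduction of the original
configuration, provided the latter is not stuck before its client succeeds. -/
theorem Red.of_append {c d : Conf} {δ γ : Hist} (hc : Stuck c → c.c = some RC.one)
    (h : Red (c.append δ γ) d) : ∃ e : Conf, d = e.append δ γ ∧ Red c e := by
  generalize hη : c.append δ γ = η at h
  cases h with
  | fwd _ _ h =>
    subst hη
    obtain ⟨e, rfl, he⟩ := h.of_append
    exact ⟨e, rfl, .fwd _ _ he⟩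
  | rbk δ₁ δ₂ γ₁ γ₂ ρ ρ' σ σ' hρ hF h₁ h₂ =>
    obtain ⟨cH, ρ₀, sH, σ₀⟩ := c
    obtain ⟨rfl, rfl, rfl, rfl⟩ := Conf.mk.inj hη
    have hF' : ∀ e, ¬ FRed ⟨cH, ρ₀, sH, σ₀⟩ e := fun e he => hF _ (he.append δ γ)
    obtain ⟨e, he⟩ : ∃ e, Red ⟨cH, ρ₀, sH, σ₀⟩ e := by
      by_contra! hs
      exact hρ (hc hs)
    cases he with
    | fwd _ _ he => exact absurd he (hF' _)
    | rbk _ δ₃ _ γ₃ _ ρ₃ _ σ₃ _ _ h₃ h₄ =>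
      have e₁ := (h₃.append δ).eq_cons_of_rb.symm.trans h₁.eq_cons_of_rb
      have e₂ := (h₄.append γ).eq_cons_of_rb.symm.trans h₂.eq_cons_of_rb
      obtain ⟨rfl, rfl⟩ := List.cons.inj e₁
      obtain ⟨rfl, rfl⟩ := List.cons.inj e₂
      exact ⟨⟨δ₃, ρ₃, γ₃, σ₃⟩, rfl, .rbk _ _ _ _ _ _ _ _ hρ hF' h₃ h₄⟩

/-- compliance is preserved by concatenating arbitrary histories
below the current ones (the head of the list is the top of the stack, so
prepending below is appending on the right). -/
theorem compliance_preserved_by_history_extension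
    (δ γ : Hist) (ρ σ : Option RC) (h : CompliantCH δ ρ γ σ) :
    ∀ δ' γ' : Hist, CompliantCH (δ ++ δ') ρ (γ ++ γ') σ := by
  intro δ' γ' c' hr hs
  obtain ⟨e, rfl, he⟩ : ∃ e : Conf, c' = e.append δ' γ' ∧ Reds ⟨δ, ρ, γ, σ⟩ e := by
    clear hs
    induction hr with
    | refl => exact ⟨⟨δ, ρ, γ, σ⟩, rfl, .refl⟩
    | tail _ hstep ih =>
      obtain ⟨e, rfl, he⟩ := ih
      obtain ⟨e', rfl, he'⟩ := hstep.of_append (h e he)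
      exact ⟨e', rfl, he.tail he'⟩
  exact h e he fun d hd => hs _ (hd.append δ' γ')
end

section
/- (Non-compliance of unretractable output against a retractable input sum missing a branch.) If ρ = ⊕_{i∈I} ā_i.ρ_i is an unretractable output choice and σ = Σ_{j∈J} a_j.σ_j is a retractable input choice with I ⊄ J, then ρ is not compliant with σ: there is a reduction ⟨[]⟩ρ ∥ ⟨[]⟩σ →* ⟨[]⟩(ā_k.ρ_k) ∥ ⟨[]⟩σ, for k ∈ I \ J, to a stuck configuration whose client is different from 1. -/
theorem Step.name_mem_of_ext {γ δ : Hist} {p q : Bool} {l : List (ℕ × RC)} {a : ℕ}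
    {σ : Option RC} (h : Step γ (some (.ext p l)) (.act q a) δ σ) : a ∈ l.map Prod.fst := by
  cases h
  simp

theorem Step.act_eq_of_intSum_singleton {γ δ : Hist} {q : Bool} {a b : ℕ} {ρ : RC}
    {σ : Option RC} (h : Step γ (some (.intSum [(a, ρ)])) (.act q b) δ σ) : b = a := by
  cases h
  rfl

theorem stuck_intSum_singleton_ext {p : Bool} {l : List (ℕ × RC)} {k : ℕ} {ρ : RC}
    (hk : k ∉ l.map Prod.fst) :
    Stuck ⟨[], some (.intSum [(k, ρ)]), [], some (.ext p l)⟩ := by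
  intro c hc
  cases hc with
  | fwd _ _ h =>
    cases h with
    | comm _ _ _ _ _ _ _ _ q a hρ hσ =>
      exact hk (hρ.act_eq_of_intSum_singleton ▸ hσ.name_mem_of_ext)
    | tauL _ _ _ _ _ _ h =>
      cases h with
      | intTau _ _ _ _ _ hlen => simp at hlen
    | tauR _ _ _ _ _ _ h => cases h
  | rbk _ _ _ _ _ _ _ _ _ _ h _ => cases h

theorem reds_intSum_singleton {δ γ : Hist} {l : List (ℕ × RC)} {k : ℕ} {ρ : RC}
    {σ : Option RC} (hk : (k, ρ) ∈ l) :
    Reds ⟨δ, some (.intSum l), γ, σ⟩ ⟨δ, some (.intSum [(k, ρ)]), γ, σ⟩ := by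
  by_cases hl : 2 ≤ l.length
  · exact .single (.fwd _ _ (.tauL _ _ _ _ _ _ (.intTau _ _ _ _ hk hl)))
  · obtain ⟨x, rfl⟩ : ∃ x, l = [x] :=
      List.length_eq_one_iff.mp (by have := List.length_pos_of_mem hk; omega)
    obtain rfl := List.mem_singleton.mp hk
    exact .refl

/-- an unretractable output `⊕_{i∈I} āᵢ.ρᵢ` against a retractable
input sum `Σ_{j∈J} aⱼ.σⱼ` with `I ⊄ J` (witnessed by `k ∈ I \\ J`) is not
compliant: there is a reduction to the stuck configuration
`⟨[]⟩āₖ.ρₖ ∥ ⟨[]⟩Σ aⱼ.σⱼ`, whose client is different from `1`. -/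
theorem unretractable_output_missing_branch (lρ lσ : List (ℕ × RC))
    (k : ℕ) (ρk : RC)
    (hwfρ : WF (.intSum lρ)) (hwfσ : WF (.ext true lσ))
    (hk : (k, ρk) ∈ lρ) (hknot : k ∉ lσ.map Prod.fst) :
    ¬ Compliant (.intSum lρ) (.ext true lσ) ∧
    Reds ⟨[], some (.intSum lρ), [], some (.ext true lσ)⟩
         ⟨[], some (.intSum [(k, ρk)]), [], some (.ext true lσ)⟩ ∧
    Stuck ⟨[], some (.intSum [(k, ρk)]), [], some (.ext true lσ)⟩ ∧
    RC.intSum [(k, ρk)] ≠ RC.one := by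
  have hreds : Reds ⟨[], some (.intSum lρ), [], some (.ext true lσ)⟩
      ⟨[], some (.intSum [(k, ρk)]), [], some (.ext true lσ)⟩ := reds_intSum_singleton hk
  have hstuck : Stuck ⟨[], some (.intSum [(k, ρk)]), [], some (.ext true lσ)⟩ :=
    stuck_intSum_singleton_ext hknot
  refine ⟨fun hcomp => ?_, hreds, hstuck, nofun⟩
  exact absurd (hcomp _ hreds hstuck) (by simp)
end

section
/- (Completeness of the formal system.) For all retractable contracts ρ and σ, if ρ is compliant with σ (ρ ⫤ σ), then the judgment ▷ ρ ⊣ σ is derivable in the formal system with empty set of hypotheses. -/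
namespace RC

@[simp] theorem subst_one (k : ℕ) (u : RC) : subst .one k u = .one := by
  rw [subst]

@[simp] theorem subst_var (n k : ℕ) (u : RC) :
    subst (.var n) k u = if n = k then u else .var n := by
  rw [subst]

@[simp] theorem subst_mu (σ : RC) (k : ℕ) (u : RC) :
    subst (.mu σ) k u = .mu (subst σ (k + 1) u) := by
  rw [subst]

@[simp] theorem subst_ext (p : Bool) (l : List (ℕ × RC)) (k : ℕ) (u : RC) :
    subst (.ext p l) k u = .ext p (l.map fun x => (x.1, subst x.2 k u)) := by
  rw [subst]
  congr 1
  exact List.attach_map_val (f := fun x : ℕ × RC => (x.1, subst x.2 k u))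

@[simp] theorem subst_intSum (l : List (ℕ × RC)) (k : ℕ) (u : RC) :
    subst (.intSum l) k u = .intSum (l.map fun x => (x.1, subst x.2 k u)) := by
  rw [subst]
  congr 1
  exact List.attach_map_val (f := fun x : ℕ × RC => (x.1, subst x.2 k u))

theorem WFa.mono {n m : ℕ} {t : RC} (h : WFa n t) (hnm : n ≤ m) : WFa m t := by
  induction h generalizing m with
  | one => exact .one _
  | var n k hk => exact .var _ _ (by omega)
  | ext n p l h0 h1 _ ih => exact .ext _ _ _ h0 h1 fun x hx => ih x hx hnm
  | intSum n l h0 h1 _ ih => exact .intSum _ _ h0 h1 fun x hx => ih x hx hnm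
  | mu n σ h0 _ ih => exact .mu _ _ h0 (ih (by omega))

theorem WFa.subst_eq_self {n : ℕ} {t : RC} (h : WFa n t) {k : ℕ} (hk : n ≤ k) (u : RC) :
    subst t k u = t := by
  induction h generalizing k with
  | one => simp
  | var n m hm => simp; omega
  | ext n p l _ _ _ ih =>
    simp only [subst_ext, ext.injEq, true_and]
    exact (List.map_congr_left fun x hx => by rw [ih x hx hk]).trans (List.map_id' l)
  | intSum n l _ _ _ ih =>
    simp only [subst_intSum, intSum.injEq]
    exact (List.map_congr_left fun x hx => by rw [ih x hx hk]).trans (List.map_id' l)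
  | mu n σ _ _ ih => simp [ih (Nat.succ_le_succ hk)]

theorem subst_ne_var {t : RC} (h : ∀ m, t ≠ .var m) (k : ℕ) (u : RC) (m : ℕ) :
    subst t k u ≠ .var m := by
  cases t <;> simp_all

theorem WFa.subst {n k : ℕ} {t u : RC} (h : WFa n t) (hn : n = k + 1) (hu : WFa 0 u) :
    WFa k (subst t k u) := by
  induction h generalizing k with
  | one => simpa using .one _
  | var n m hm =>
    rw [subst_var]
    split_ifs
    · exact hu.mono (Nat.zero_le _)
    · exact .var _ _ (by omega)
  | ext n p l h0 h1 _ ih =>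
    rw [subst_ext]
    refine .ext _ _ _ (by simpa using h0) (by simpa [Function.comp_def] using h1) ?_
    simp only [List.mem_map]
    rintro _ ⟨x, hx, rfl⟩
    exact ih x hx hn
  | intSum n l h0 h1 _ ih =>
    rw [subst_intSum]
    refine .intSum _ _ (by simpa using h0) (by simpa [Function.comp_def] using h1) ?_
    simp only [List.mem_map]
    rintro _ ⟨x, hx, rfl⟩
    exact ih x hx hn
  | mu n σ h0 _ ih =>
    rw [subst_mu]
    exact .mu _ _ (subst_ne_var h0 _ _) (ih (by omega))

theorem WFa.unf {σ : RC} (h : WFa 0 (.mu σ)) : WFa 0 (unf σ) := by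
  have hσ := h
  cases h with
  | mu _ _ _ h => exact h.subst rfl hσ

/-- The number of recursion binders at the head of an expression. -/
def headMus : RC → ℕ
  | .mu σ => headMus σ + 1
  | .one | .var _ | .ext _ _ | .intSum _ => 0

theorem WFa.headMus_subst {n : ℕ} {t : RC} (h : WFa n t) (ht : ∀ m, t ≠ .var m) (k : ℕ) (u : RC) :
    headMus (RC.subst t k u) = headMus t := by
  induction h generalizing k with
  | one => simp
  | var n m _ => exact absurd rfl (ht m)
  | ext => simp [headMus]
  | intSum => simp [headMus]
  | mu n σ h0 _ ih => simp [headMus, ih h0]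

theorem WFa.exists_unf {t : RC} (h : WFa 0 t) : ∃ τ, Unf t τ := by
  induction hk : headMus t generalizing t with
  | zero =>
    cases t with
    | one => exact ⟨_, .one⟩
    | ext => exact ⟨_, .ext _ _⟩
    | intSum => exact ⟨_, .intSum _⟩
    | var => exact ⟨_, .var _⟩
    | mu => simp [headMus] at hk
  | succ k ih =>
    cases t with
    | mu σ =>
      have hu := h.unf
      cases h with
      | mu _ _ h0 h1 =>
        obtain ⟨τ, hτ⟩ := ih hu (by
          rw [RC.unf, h1.headMus_subst h0]
          simpa [headMus] using hk)
        exact ⟨τ, .mu _ _ hτ⟩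
    | _ => simp [headMus] at hk

/-- Simultaneous substitution of the closed terms of a list for the variables `k, k + 1, …`. -/
def closeWith (t : RC) : ℕ → List RC → RC
  | _, [] => t
  | k, u :: env => subst (closeWith t (k + 1) env) k u

theorem closeWith_one (k : ℕ) (env : List RC) : closeWith .one k env = .one := by
  induction env generalizing k with
  | nil => rfl
  | cons u env ih => simp [closeWith, ih]

theorem closeWith_mu (σ : RC) (k : ℕ) (env : List RC) :
    closeWith (.mu σ) k env = .mu (closeWith σ (k + 1) env) := by
  induction env generalizing k with
  | nil => rfl
  | cons u env ih => simp [closeWith, ih]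

theorem closeWith_ext (p : Bool) (l : List (ℕ × RC)) (k : ℕ) (env : List RC) :
    closeWith (.ext p l) k env = .ext p (l.map fun x => (x.1, closeWith x.2 k env)) := by
  induction env generalizing k with
  | nil => simp [closeWith]
  | cons u env ih => simp [closeWith, ih]

theorem closeWith_intSum (l : List (ℕ × RC)) (k : ℕ) (env : List RC) :
    closeWith (.intSum l) k env = .intSum (l.map fun x => (x.1, closeWith x.2 k env)) := by
  induction env generalizing k with
  | nil => simp [closeWith]
  | cons u env ih => simp [closeWith, ih]

theorem closeWith_var_of_lt {n k : ℕ} (h : n < k) (env : List RC) :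
    closeWith (.var n) k env = .var n := by
  induction env generalizing k with
  | nil => rfl
  | cons u env ih => simp [closeWith, ih (Nat.lt_succ_of_lt h), h.ne]

theorem closeWith_var_mem {n k : ℕ} {env : List RC} (henv : ∀ u ∈ env, WFa 0 u)
    (hk : k ≤ n) (hn : n < k + env.length) : closeWith (.var n) k env ∈ env := by
  induction env generalizing k with
  | nil => simp at hn; omega
  | cons u env ih =>
    rw [closeWith]
    obtain rfl | hlt := hk.eq_or_lt
    · simp [closeWith_var_of_lt (Nat.lt_succ_self k)]
    · have hm := ih (fun v hv => henv v (List.mem_cons_of_mem _ hv)) hlt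
        (by simp at hn; omega)
      rw [(henv _ (List.mem_cons_of_mem _ hm)).subst_eq_self (Nat.zero_le _)]
      exact List.mem_cons_of_mem _ hm

theorem WFa.closeWith {n k : ℕ} {t : RC} {env : List RC} (h : WFa n t)
    (henv : ∀ u ∈ env, WFa 0 u) (hn : n = k + env.length) : WFa k (closeWith t k env) := by
  induction env generalizing k with
  | nil => simpa [RC.closeWith, hn] using h
  | cons u env ih =>
    refine (ih (k := k + 1) (fun v hv => henv v (List.mem_cons_of_mem _ hv)) ?_).subst rfl
      (henv u List.mem_cons_self)
    simp at hn; omega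

/-- Immediate successors of an expression: unfolding of recursion, and branches of choices. -/
inductive Succ : RC → RC → Prop
  | unf (σ : RC) : Succ (.mu σ) (unf σ)
  | ext (p : Bool) {l : List (ℕ × RC)} {x : ℕ × RC} (hx : x ∈ l) : Succ (.ext p l) x.2
  | intSum {l : List (ℕ × RC)} {x : ℕ × RC} (hx : x ∈ l) : Succ (.intSum l) x.2

theorem WFa.succ {s t : RC} (h : WFa 0 s) (hst : Succ s t) : WFa 0 t := by
  cases hst with
  | unf => exact h.unf
  | ext p hx => cases h with | ext _ _ _ _ _ h => exact h _ hx
  | intSum hx => cases h with | intSum _ _ _ _ h => exact h _ hx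

/-- `S` is closed under successors up to `E`. -/
def ClosedUpTo (S E : Set RC) : Prop := ∀ s ∈ S, ∀ t, Succ s t → t ∈ S ∪ E

theorem exists_finite_insert_closedUpTo {l : List (ℕ × RC)} {E : Set RC} {f : RC → RC} {t : RC}
    (h : ∀ x ∈ l, ∃ S : Set RC, S.Finite ∧ f x.2 ∈ S ∪ E ∧ ClosedUpTo S E)
    (ht : ∀ s, Succ t s → ∃ x ∈ l, s = f x.2) :
    ∃ S : Set RC, S.Finite ∧ t ∈ S ∪ E ∧ ClosedUpTo S E := by
  choose! S hfin hmem hcl using h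
  refine ⟨insert t (⋃ x ∈ {x | x ∈ l}, S x),
    ((List.finite_toSet l).biUnion hfin).insert t, by simp, ?_⟩
  have hsub : ∀ x ∈ l, S x ∪ E ⊆ insert t (⋃ x ∈ {x | x ∈ l}, S x) ∪ E := fun x hx =>
    Set.union_subset_union_left _
      ((Set.subset_biUnion_of_mem (u := S) (s := {x | x ∈ l}) hx).trans (Set.subset_insert _ _))
  rintro s (rfl | hs) s' hs'
  · obtain ⟨x, hx, rfl⟩ := ht _ hs'
    exact hsub x hx (hmem x hx)
  · simp only [Set.mem_iUnion] at hs
    obtain ⟨x, hx, hs⟩ := hs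
    exact hsub x hx (hcl x hx s hs s' hs')

theorem WFa.exists_finite_closedUpTo {n : ℕ} {t : RC} (h : WFa n t) (env : List RC) (E : Set RC)
    (hn : env.length = n) (henv : ∀ u ∈ env, WFa 0 u) (hE : ∀ u ∈ env, u ∈ E) :
    ∃ S : Set RC, S.Finite ∧ RC.closeWith t 0 env ∈ S ∪ E ∧ ClosedUpTo S E := by
  induction h generalizing env E with
  | one n =>
    refine ⟨{.one}, Set.finite_singleton _, by simp [closeWith_one], ?_⟩
    rintro s rfl t ⟨⟩
  | var n m hm =>
    exact ⟨∅, Set.finite_empty,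
      .inr (hE _ (closeWith_var_mem henv (Nat.zero_le _) (by omega))), fun _ h => h.elim⟩
  | ext n p l _ _ _ ih =>
    refine exists_finite_insert_closedUpTo (f := fun t => RC.closeWith t 0 env)
      (fun x hx => ih x hx env E hn henv hE) ?_
    rw [closeWith_ext]
    rintro _ (_ | ⟨_, hx⟩)
    obtain ⟨y, hy, rfl⟩ := List.mem_map.1 hx
    exact ⟨y, hy, rfl⟩
  | intSum n l _ _ _ ih =>
    refine exists_finite_insert_closedUpTo (f := fun t => RC.closeWith t 0 env)
      (fun x hx => ih x hx env E hn henv hE) ?_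
    rw [closeWith_intSum]
    rintro _ (_ | _ | hx)
    obtain ⟨y, hy, rfl⟩ := List.mem_map.1 hx
    exact ⟨y, hy, rfl⟩
  | mu n σ h0 h1 ih =>
    have hwf : WFa 0 (RC.closeWith (.mu σ) 0 env) :=
      (WFa.mu n σ h0 h1).closeWith henv (by omega)
    set t := RC.closeWith (.mu σ) 0 env with ht
    obtain ⟨S, hfin, hmem, hcl⟩ := ih (t :: env) (insert t E) (by simp [hn])
      (by simpa using ⟨hwf, henv⟩)
      (by simpa using fun u hu => Or.inr (hE u hu))
    have heq : S ∪ insert t E = insert t S ∪ E := by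
      rw [Set.union_insert, Set.insert_union]
    rw [heq] at hmem
    refine ⟨insert t S, hfin.insert t, by simp, ?_⟩
    rintro s (rfl | hs) s' hs'
    · have hunf : s' = RC.closeWith σ 0 (t :: env) := by
        rw [ht, closeWith_mu] at hs'
        cases hs'
        rw [RC.closeWith, ht, closeWith_mu, RC.unf]
      rwa [hunf]
    · exact heq ▸ hcl s hs s' hs'

/-- A closed expression has finitely many iterated successors. -/
theorem WFa.exists_finite_closed {t : RC} (h : WFa 0 t) :
    ∃ S : Set RC, S.Finite ∧ t ∈ S ∧ ∀ s ∈ S, ∀ s', Succ s s' → s' ∈ S := by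
  simpa [ClosedUpTo, RC.closeWith] using h.exists_finite_closedUpTo [] ∅ rfl (by simp) (by simp)

end RC

theorem Unf.mem {S : Set RC} (hS : ∀ s ∈ S, ∀ s', RC.Succ s s' → s' ∈ S) {t τ : RC}
    (h : Unf t τ) (ht : t ∈ S) : τ ∈ S := by
  induction h with
  | mu σ τ _ ih => exact ih (hS _ ht _ (.unf σ))
  | _ => exact ht

theorem Unf.ne_mu {t τ : RC} (h : Unf t τ) (σ : RC) : τ ≠ .mu σ := by
  induction h with
  | mu _ _ _ ih => exact ih
  | _ => simp

theorem Derives.of_unf_left {Γ : List (RC × RC)} {ρ ρ' σ : RC} (hρ : Unf ρ ρ')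
    (h : Derives Γ ρ' σ) : Derives Γ ρ σ := by
  induction hρ with
  | mu _ _ _ ih => exact .unfoldL _ _ _ (ih h)
  | _ => exact h

theorem Derives.of_unf_right {Γ : List (RC × RC)} {ρ σ σ' : RC} (hσ : Unf σ σ')
    (h : Derives Γ ρ σ') : Derives Γ ρ σ := by
  induction hσ with
  | mu _ _ _ ih => exact .unfoldR _ _ _ (ih h)
  | _ => exact h

/-- `c` and `c'` have the same transitions. -/
def SameSteps (c c' : Option RC) : Prop :=
  ∀ γ α δ r, Step γ c α δ r ↔ Step γ c' α δ r

theorem SameSteps.refl (c : Option RC) : SameSteps c c := fun _ _ _ _ => Iff.rfl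

theorem step_mu_iff {γ δ : Hist} {σ : RC} {α : Act} {r : Option RC} :
    Step γ (some (.mu σ)) α δ r ↔ Step γ (some (RC.unf σ)) α δ r := by
  refine ⟨fun h => ?_, .mu _ _ _ _ _⟩
  cases h with
  | rb => exact .rb _ _ _
  | mu _ _ _ _ _ h => exact h

theorem Unf.sameSteps {t τ : RC} (h : Unf t τ) : SameSteps (some τ) (some t) := by
  induction h with
  | mu σ τ _ ih => exact fun _ _ _ _ => (ih _ _ _ _).trans step_mu_iff.symm
  | _ => exact .refl _

theorem step_rb_iff {γ δ : Hist} {c r : Option RC} : Step γ c .rb δ r ↔ γ = r :: δ := by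
  refine ⟨fun h => ?_, fun h => h ▸ .rb _ _ _⟩
  generalize hα : Act.rb = α at h
  induction h with
  | rb => rfl
  | mu _ _ _ _ _ _ ih => exact ih hα
  | _ => cases hα

theorem Step.of_ext {γ δ : Hist} {p : Bool} {l : List (ℕ × RC)} {α : Act} {r : Option RC}
    (h : Step γ (some (.ext p l)) α δ r) : α = .rb ∨ ∃ a ∈ l.map Prod.fst, α = .act p a := by
  generalize hc : some (RC.ext p l) = c at h
  cases h with
  | rb => exact .inl rfl
  | ext => cases hc; simp
  | _ => cases hc

theorem Step.of_intSum_singleton {γ δ : Hist} {x : ℕ × RC} {α : Act} {r : Option RC}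
    (h : Step γ (some (.intSum [x])) α δ r) : α = .rb ∨ α = .act false x.1 := by
  cases h <;> simp at *

theorem Step.of_none {γ δ : Hist} {α : Act} {r : Option RC} (h : Step γ none α δ r) :
    α = .rb := by
  cases h; rfl

theorem sameSteps_restOf (p : Bool) (l : List (ℕ × RC)) :
    SameSteps (some (.ext p l)) (restOf p l) := by
  cases l with
  | cons => exact .refl _
  | nil =>
    refine fun γ α δ r => ⟨fun h => ?_, fun h => ?_⟩
    · obtain rfl : α = .rb := by simpa using h.of_ext
      exact step_rb_iff.2 (step_rb_iff.1 h)
    · cases h; exact .rb _ _ _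

theorem restOf_ne_one (p : Bool) (l : List (ℕ × RC)) : restOf p l ≠ some .one := by
  cases l <;> simp [restOf]

/-- `Y` has the histories of `X` and the same transitions on both sides, and its client is `1`
only if that of `X` is. -/
structure Sim (X Y : Conf) : Prop where
  cH : X.cH = Y.cH
  sH : X.sH = Y.sH
  c : SameSteps X.c Y.c
  s : SameSteps X.s Y.s
  one : Y.c = some .one → X.c = some .one

theorem Sim.refl (X : Conf) : Sim X X := ⟨rfl, rfl, .refl _, .refl _, id⟩

theorem Sim.not_fRed {X Y : Conf} (h : Sim X Y) (hX : ∀ d, ¬ FRed X d) (d : Conf) :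
    ¬ FRed Y d := by
  obtain ⟨δ, ρ, γ, σ⟩ := X
  obtain ⟨_, ρ', _, σ'⟩ := Y
  obtain ⟨rfl, rfl, hc, hs, -⟩ := h
  rintro (⟨_, _, _, _, _, _, _, _, _, _, h1, h2⟩ | ⟨_, _, _, _, _, _, h1⟩ | ⟨_, _, _, _, _, _, h1⟩)
  · exact hX _ (.comm _ _ _ _ _ _ _ _ _ _ ((hc _ _ _ _).2 h1) ((hs _ _ _ _).2 h2))
  · exact hX _ (.tauL _ _ _ _ _ _ ((hc _ _ _ _).2 h1))
  · exact hX _ (.tauR _ _ _ _ _ _ ((hs _ _ _ _).2 h1))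

theorem Sim.red {X Y X' : Conf} (h : Sim X Y) (hX : Red X X') : ∃ Y', Red Y Y' ∧ Sim X' Y' := by
  have hf := h.not_fRed
  obtain ⟨_, ρ', _, σ'⟩ := Y
  cases hX with
  | fwd _ _ hX =>
    cases hX with
    | comm _ _ _ _ _ _ _ _ _ _ h1 h2 =>
      obtain ⟨rfl, rfl, hc, hs, -⟩ := h
      exact ⟨_, .fwd _ _ (.comm _ _ _ _ _ _ _ _ _ _ ((hc _ _ _ _).1 h1) ((hs _ _ _ _).1 h2)),
        .refl _⟩
    | tauL _ _ _ _ _ _ h1 =>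
      obtain ⟨rfl, rfl, hc, hs, -⟩ := h
      exact ⟨_, .fwd _ _ (.tauL _ _ _ _ _ _ ((hc _ _ _ _).1 h1)), rfl, rfl, .refl _, hs, id⟩
    | tauR _ _ _ _ _ _ h1 =>
      obtain ⟨rfl, rfl, hc, hs, h0⟩ := h
      exact ⟨_, .fwd _ _ (.tauR _ _ _ _ _ _ ((hs _ _ _ _).1 h1)), rfl, rfl, hc, .refl _, h0⟩
  | rbk _ _ _ _ _ _ _ _ h0 hX h1 h2 =>
    obtain ⟨rfl, rfl, hc, hs, hone⟩ := h
    exact ⟨_, .rbk _ _ _ _ _ _ _ _ (fun h => h0 (hone h)) (hf hX) ((hc _ _ _ _).1 h1)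
      ((hs _ _ _ _).1 h2), .refl _⟩

theorem Sim.reds {X Y X' : Conf} (h : Sim X Y) (hX : Reds X X') :
    ∃ Y', Reds Y Y' ∧ Sim X' Y' := by
  induction hX with
  | refl => exact ⟨Y, .refl, h⟩
  | tail _ hr ih =>
    obtain ⟨Z, hZ, hs⟩ := ih
    obtain ⟨Z', hr', hs'⟩ := hs.red hr
    exact ⟨Z', hZ.tail hr', hs'⟩

/-- The pair can reduce to one with the same histories, whose client is not `1` and which has no
forward reduction. -/
def Failing (δ : Hist) (c : Option RC) (γ : Hist) (s : Option RC) : Prop :=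
  ∃ c' s', Reds ⟨δ, c, γ, s⟩ ⟨δ, c', γ, s'⟩ ∧ c' ≠ some .one ∧ ∀ d, ¬ FRed ⟨δ, c', γ, s'⟩ d

namespace Failing

variable {δ γ : Hist} {c c' s s' : Option RC}

theorem of_reds (h : Reds ⟨δ, c, γ, s⟩ ⟨δ, c', γ, s'⟩) (hf : Failing δ c' γ s') :
    Failing δ c γ s := by
  obtain ⟨d, t, h', hd⟩ := hf
  exact ⟨d, t, Relation.ReflTransGen.trans h h', hd⟩

theorem congr (hc : SameSteps c c') (hs : SameSteps s s') (h1 : c' ≠ some .one)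
    (hf : Failing δ c γ s) : Failing δ c' γ s' := by
  obtain ⟨d, t, hr, hd, hb⟩ := hf
  obtain ⟨⟨_, d', _, t'⟩, hr', hsim⟩ :=
    Sim.reds (X := ⟨δ, c, γ, s⟩) (Y := ⟨δ, c', γ, s'⟩) ⟨rfl, rfl, hc, hs, fun h => absurd h h1⟩ hr
  have hb' := hsim.not_fRed hb
  obtain ⟨rfl, rfl, -, -, hone⟩ := hsim
  exact ⟨d', t', hr', fun h => hd (hone h), hb'⟩

/-- A communication leading to a failing pair, followed by a rollback to a failing pair. -/
theorem of_comm {r r' : Option RC} {p : Bool} {a : ℕ}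
    (h1 : Step δ c (.act p a) (r :: δ) c') (h2 : Step γ s (.act (!p) a) (r' :: γ) s')
    (hf : Failing (r :: δ) c' (r' :: γ) s') (hr : Failing δ r γ r') : Failing δ c γ s := by
  obtain ⟨d, t, hr', hd, hb⟩ := hf
  refine of_reds (.head (.fwd _ _ (.comm _ _ _ _ _ _ _ _ _ _ h1 h2)) (.tail hr' ?_)) hr
  exact .rbk _ _ _ _ _ _ _ _ hd hb (.rb _ _ _) (.rb _ _ _)

/-- A pair without internal steps and without dual actions is failing. -/
theorem of_steps (h1 : c ≠ some .one)
    (hc : ∀ δ' r, ¬ Step δ c .tau δ' r) (hs : ∀ γ' r, ¬ Step γ s .tau γ' r)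
    (h : ∀ p a δ' r γ' r', Step δ c (.act p a) δ' r → ¬ Step γ s (.act (!p) a) γ' r') :
    Failing δ c γ s := by
  refine ⟨c, s, .refl, h1, ?_⟩
  rintro _ (⟨_, _, _, _, _, _, _, _, _, _, h1, h2⟩ | ⟨_, _, _, _, _, _, h1⟩ |
    ⟨_, _, _, _, _, _, h1⟩)
  · exact h _ _ _ _ _ _ h1 h2
  · exact hc _ _ h1
  · exact hs _ _ h1

end Failing

theorem intSum_cases {l : List (ℕ × RC)} {x : ℕ × RC} (hx : x ∈ l) (γ : Hist) :
    l = [x] ∨ Step γ (some (.intSum l)) .tau γ (some (.intSum [x])) := by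
  rcases l with _ | ⟨y, _ | ⟨z, l⟩⟩
  · simp at hx
  · simp_all
  · exact .inr (.intTau _ _ _ _ hx (by simp))

theorem reds_intSum_left {l : List (ℕ × RC)} {x : ℕ × RC} (hx : x ∈ l) (δ γ : Hist)
    (s : Option RC) : Reds ⟨δ, some (.intSum l), γ, s⟩ ⟨δ, some (.intSum [x]), γ, s⟩ := by
  obtain rfl | h := intSum_cases hx δ
  · exact .refl
  · exact .single (.fwd _ _ (.tauL _ _ _ _ _ _ h))

theorem reds_intSum_right {l : List (ℕ × RC)} {x : ℕ × RC} (hx : x ∈ l) (δ γ : Hist)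
    (c : Option RC) : Reds ⟨δ, c, γ, some (.intSum l)⟩ ⟨δ, c, γ, some (.intSum [x])⟩ := by
  obtain rfl | h := intSum_cases hx γ
  · exact .refl
  · exact .single (.fwd _ _ (.tauR _ _ _ _ _ _ h))

/-- The polarity of the actions offered by an expression without head recursion. -/
def HasPolarity (p : Bool) : RC → Prop
  | .ext q _ => p = q
  | .intSum _ => p = false
  | .one | .var _ | .mu _ => False

/-- An expression can resolve its internal choice, if any, keeping its polarity. -/
theorem exists_resolved {t : RC} (ht : ∀ σ, t ≠ .mu σ) :
    ∃ t', (t' = t ∨ ∃ l, ∃ x ∈ l, t = .intSum l ∧ t' = .intSum [x]) ∧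
      ∀ γ α δ r, Step γ (some t') α δ r → α = .rb ∨ ∃ p a, HasPolarity p t ∧ α = .act p a := by
  cases t with
  | mu σ => exact absurd rfl (ht σ)
  | one => exact ⟨_, .inl rfl, fun _ _ _ _ h => by cases h; simp⟩
  | var => exact ⟨_, .inl rfl, fun _ _ _ _ h => by cases h; simp⟩
  | ext p l =>
    refine ⟨_, .inl rfl, fun _ _ _ _ h => ?_⟩
    obtain h | ⟨a, -, h⟩ := h.of_ext
    · exact .inl h
    · exact .inr ⟨p, a, rfl, h⟩
  | intSum l =>
    cases l with
    | nil =>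
      exact ⟨_, .inl rfl, fun _ _ _ _ h => by
        cases h with
        | rb => exact .inl rfl
        | intTau _ _ _ _ h => simp at h⟩
    | cons x l =>
      exact ⟨.intSum [x], .inr ⟨x :: l, x, by simp, rfl, rfl⟩, fun _ _ _ _ h =>
        h.of_intSum_singleton.imp_right fun h => ⟨false, x.1, rfl, h⟩⟩

theorem Failing.of_polarity {ρ σ : RC} (hρ : ∀ τ, ρ ≠ .mu τ) (hσ : ∀ τ, σ ≠ .mu τ)
    (h1 : ρ ≠ .one) (h : ∀ p, HasPolarity p ρ → ¬ HasPolarity (!p) σ) (δ γ : Hist) :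
    Failing δ (some ρ) γ (some σ) := by
  obtain ⟨ρ', hρ', hactρ⟩ := exists_resolved hρ
  obtain ⟨σ', hσ', hactσ⟩ := exists_resolved hσ
  have hredρ : Reds ⟨δ, some ρ, γ, some σ⟩ ⟨δ, some ρ', γ, some σ⟩ := by
    obtain rfl | ⟨l, x, hx, rfl, rfl⟩ := hρ'
    · exact .refl
    · exact reds_intSum_left hx _ _ _
  have hredσ : Reds ⟨δ, some ρ', γ, some σ⟩ ⟨δ, some ρ', γ, some σ'⟩ := by
    obtain rfl | ⟨l, x, hx, rfl, rfl⟩ := hσ'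
    · exact .refl
    · exact reds_intSum_right hx _ _ _
  refine .of_reds hredρ (.of_reds hredσ (.of_steps ?_ ?_ ?_ ?_))
  · obtain rfl | ⟨l, x, hx, rfl, rfl⟩ := hρ'
    · simpa using h1
    · simp
  · exact fun _ _ hs => by simpa using hactρ _ _ _ _ hs
  · exact fun _ _ hs => by simpa using hactσ _ _ _ _ hs
  · intro p a _ _ _ _ hs hs'
    have hp : HasPolarity p ρ := by simpa using hactρ _ _ _ _ hs
    obtain hs' | ⟨q, b, hq, hs'⟩ := hactσ _ _ _ _ hs'
    · cases hs'
    · cases hs'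
      exact h p hp hq

theorem Failing.ext_ext {p : Bool} {l l' : List (ℕ × RC)}
    (h : ∀ a ρ σ, (a, ρ) ∈ l → (a, σ) ∈ l' → ∀ δ γ, Failing δ (some ρ) γ (some σ)) (δ γ : Hist) :
    Failing δ (some (.ext p l)) γ (some (.ext (!p) l')) := by
  induction hn : l.length generalizing l l' with
  | zero =>
    obtain rfl : l = [] := List.length_eq_zero_iff.1 hn
    refine .of_steps (by simp) (fun _ _ hs => by simpa using hs.of_ext)
      (fun _ _ hs => by simpa using hs.of_ext) fun _ _ _ _ _ _ hs _ => by simpa using hs.of_ext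
  | succ n ih =>
    by_cases hcom : ∃ a ρ σ, (a, ρ) ∈ l ∧ (a, σ) ∈ l'
    · obtain ⟨a, ρ, σ, hρ, hσ⟩ := hcom
      have hf := h a ρ σ hρ hσ
      obtain ⟨l₁, l₂, rfl⟩ := List.append_of_mem hρ
      obtain ⟨l₁', l₂', rfl⟩ := List.append_of_mem hσ
      refine .of_comm (.ext _ _ _ _ _ _) (.ext _ _ _ _ _ _) (hf _ _)
        (.congr (sameSteps_restOf _ _) (sameSteps_restOf _ _) (restOf_ne_one _ _) (ih ?_ ?_))
      · refine fun b ρ' σ' hρ' hσ' => h b ρ' σ' ?_ ?_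
        · simp only [List.mem_append, List.mem_cons] at hρ' ⊢; tauto
        · simp only [List.mem_append, List.mem_cons] at hσ' ⊢; tauto
      · simp at hn ⊢; omega
    · refine .of_steps (by simp) (fun _ _ hs => by simpa using hs.of_ext)
        (fun _ _ hs => by simpa using hs.of_ext) fun q a _ _ _ _ hs hs' => hcom ?_
      obtain ⟨⟨ρ, hρ⟩, -⟩ : (∃ ρ, (a, ρ) ∈ l) ∧ q = p := by simpa using hs.of_ext
      obtain ⟨σ, hσ⟩ : ∃ σ, (a, σ) ∈ l' := by
        have := hs'.of_ext
        simp at this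
        exact this.1
      exact ⟨a, ρ, σ, hρ, hσ⟩

theorem Failing.intSum_ext_of_notMem {l l' : List (ℕ × RC)} {x : ℕ × RC} (hx : x ∈ l)
    (h : x.1 ∉ l'.map Prod.fst) (δ γ : Hist) :
    Failing δ (some (.intSum l)) γ (some (.ext true l')) := by
  refine .of_reds (reds_intSum_left hx _ _ _) (.of_steps (by simp)
    (fun _ _ hs => by simpa using hs.of_intSum_singleton) (fun _ _ hs => by simpa using hs.of_ext)
    fun q a _ _ _ _ hs hs' => h ?_)
  obtain ⟨rfl, rfl⟩ : q = false ∧ a = x.1 := by simpa using hs.of_intSum_singleton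
  simpa using hs'.of_ext

theorem Failing.ext_intSum_of_notMem {l l' : List (ℕ × RC)} {x : ℕ × RC} (hx : x ∈ l')
    (h : x.1 ∉ l.map Prod.fst) (δ γ : Hist) :
    Failing δ (some (.ext true l)) γ (some (.intSum l')) := by
  refine .of_reds (reds_intSum_right hx _ _ _) (.of_steps (by simp)
    (fun _ _ hs => by simpa using hs.of_ext) (fun _ _ hs => by simpa using hs.of_intSum_singleton)
    fun q a _ _ _ _ hs hs' => h ?_)
  obtain ⟨rfl, rfl⟩ : q = true ∧ a = x.1 := by simpa using hs'.of_intSum_singleton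
  simpa using hs.of_ext

theorem not_step_restOf_tau {p : Bool} {l : List (ℕ × RC)} {γ γ' : Hist} {r : Option RC} :
    ¬ Step γ (restOf p l) .tau γ' r := fun h => by
  simpa using ((sameSteps_restOf p l _ _ _ _).2 h).of_ext

theorem not_step_none {α : Act} (hα : α ≠ .rb) {γ γ' : Hist} {r : Option RC} :
    ¬ Step γ none α γ' r := fun h => hα h.of_none

theorem Failing.intSum_ext_of_mem {l l' : List (ℕ × RC)} {a : ℕ} {ρ σ : RC} (hρ : (a, ρ) ∈ l)
    (hσ : (a, σ) ∈ l') (h : ∀ δ γ, Failing δ (some ρ) γ (some σ)) (δ γ : Hist) :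
    Failing δ (some (.intSum l)) γ (some (.ext true l')) := by
  obtain ⟨l₁, l₂, rfl⟩ := List.append_of_mem hσ
  exact .of_reds (reds_intSum_left hρ _ _ _) (.of_comm (.intOut _ _ _) (.ext _ _ _ _ _ _) (h _ _)
    (.of_steps (by simp) (fun _ _ => not_step_none (by simp)) (fun _ _ => not_step_restOf_tau)
      fun _ _ _ _ _ _ hs => absurd hs (not_step_none (by simp))))

theorem Failing.ext_intSum_of_mem {l l' : List (ℕ × RC)} {a : ℕ} {ρ σ : RC} (hρ : (a, ρ) ∈ l)
    (hσ : (a, σ) ∈ l') (h : ∀ δ γ, Failing δ (some ρ) γ (some σ)) (δ γ : Hist) :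
    Failing δ (some (.ext true l)) γ (some (.intSum l')) := by
  obtain ⟨l₁, l₂, rfl⟩ := List.append_of_mem hρ
  exact .of_reds (reds_intSum_right hσ _ _ _) (.of_comm (.ext _ _ _ _ _ _) (.intOut _ _ _) (h _ _)
    (.of_steps (restOf_ne_one _ _) (fun _ _ => not_step_restOf_tau)
      (fun _ _ => not_step_none (by simp)) fun _ _ _ _ _ _ _ => not_step_none (by simp)))

/-- A pair of head-unfolded expressions fails if it is not derivable and all pairs of branches that
are not derivable after adding it to the hypotheses fail. -/
theorem Failing.of_branches {Γ : List (RC × RC)} {ρ σ : RC} (hρ : ∀ τ, ρ ≠ .mu τ)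
    (hσ : ∀ τ, σ ≠ .mu τ) (hd : ¬ Derives Γ ρ σ)
    (ih : ∀ ρ' σ', RC.Succ ρ ρ' → RC.Succ σ σ' → ¬ Derives ((ρ, σ) :: Γ) ρ' σ' →
      ∀ δ γ, Failing δ (some ρ') γ (some σ')) (δ γ : Hist) :
    Failing δ (some ρ) γ (some σ) := by
  have h1 : ρ ≠ .one := by
    rintro rfl
    exact hd (.ax _ _)
  by_cases hpol : ∀ p, HasPolarity p ρ → ¬ HasPolarity (!p) σ
  · exact .of_polarity hρ hσ h1 hpol δ γ
  push Not at hpol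
  obtain ⟨p, hp, hp'⟩ := hpol
  cases ρ with
  | one | var | mu => exact hp.elim
  | ext q l =>
    obtain rfl : p = q := hp
    cases σ with
    | one | var | mu => exact hp'.elim
    | ext q' l' =>
      obtain rfl : (!p) = q' := hp'
      exact .ext_ext (fun a ρ' σ' hρ' hσ' => ih ρ' σ' (.ext p hρ') (.ext _ hσ')
        fun hd' => hd (.plusPlus _ _ _ _ _ _ _ hρ' hσ' hd')) δ γ
    | intSum l' =>
      obtain rfl : p = true := by simpa [HasPolarity] using hp'
      by_cases hsub : ∀ x ∈ l', x.1 ∈ l.map Prod.fst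
      · by_contra hF
        refine hd (.plusOplus _ _ _ hsub fun a ρ' σ' hρ' hσ' => ?_)
        by_contra hd'
        exact hF (.ext_intSum_of_mem hρ' hσ' (ih _ _ (.ext _ hρ') (.intSum hσ') hd') δ γ)
      · push Not at hsub
        obtain ⟨x, hx, hx'⟩ := hsub
        exact .ext_intSum_of_notMem hx hx' δ γ
  | intSum l =>
    obtain rfl : p = false := hp
    cases σ with
    | one | var | mu => exact hp'.elim
    | intSum => simp [HasPolarity] at hp'
    | ext q' l' =>
      obtain rfl : true = q' := hp'
      by_cases hsub : ∀ x ∈ l, x.1 ∈ l'.map Prod.fst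
      · by_contra hF
        refine hd (.oplusPlus _ _ _ hsub fun a ρ' σ' hρ' hσ' => ?_)
        by_contra hd'
        exact hF (.intSum_ext_of_mem hρ' hσ' (ih _ _ (.intSum hρ') (.ext _ hσ') hd') δ γ)
      · push Not at hsub
        obtain ⟨x, hx, hx'⟩ := hsub
        exact .intSum_ext_of_notMem hx hx' δ γ

theorem Failing.of_not_derives {T : Set RC} (hfin : T.Finite)
    (hT : ∀ s ∈ T, ∀ s', RC.Succ s s' → s' ∈ T) (hwf : ∀ s ∈ T, WF s) (Γ : List (RC × RC))
    (ρ σ : RC) (hρ : ρ ∈ T) (hσ : σ ∈ T) (hd : ¬ Derives Γ ρ σ) (δ γ : Hist) :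
    Failing δ (some ρ) γ (some σ) := by
  induction hn : ((T ×ˢ T) \ {x | x ∈ Γ}).ncard using Nat.strong_induction_on
    generalizing Γ ρ σ δ γ with
  | _ n ih =>
    obtain ⟨ρ₀, hρ₀⟩ := (hwf ρ hρ).exists_unf
    obtain ⟨σ₀, hσ₀⟩ := (hwf σ hσ).exists_unf
    have hd₀ : ¬ Derives Γ ρ₀ σ₀ := fun h => hd ((h.of_unf_right hσ₀).of_unf_left hρ₀)
    have hmem : (ρ₀, σ₀) ∈ (T ×ˢ T) \ {x | x ∈ Γ} :=
      ⟨⟨hρ₀.mem hT hρ, hσ₀.mem hT hσ⟩, fun h => hd₀ (.hyp _ _ _ h)⟩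
    refine .congr hρ₀.sameSteps hσ₀.sameSteps ?_
      (.of_branches hρ₀.ne_mu hσ₀.ne_mu hd₀ (fun ρ' σ' hρ' hσ' hd' δ γ => ?_) δ γ)
    · simp only [ne_eq, Option.some.injEq]
      rintro rfl
      exact hd (.ax _ _)
    · refine ih _ ?_ _ ρ' σ' (hT _ hmem.1.1 _ hρ') (hT _ hmem.1.2 _ hσ') hd' δ γ rfl
      rw [← hn]
      refine Set.ncard_lt_ncard ?_ ((hfin.prod hfin).sdiff)
      have hsub : (T ×ˢ T) \ {x | x ∈ (ρ₀, σ₀) :: Γ} ⊆ (T ×ˢ T) \ {x | x ∈ Γ} :=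
        fun x hx => ⟨hx.1, fun h => hx.2 (List.mem_cons_of_mem _ h)⟩
      exact (Set.ssubset_iff_of_subset hsub).2 ⟨(ρ₀, σ₀), hmem, fun h => h.2 List.mem_cons_self⟩

/-- Completeness: if `ρ ⫤ σ` then the judgment `▷ ρ ⊣ σ` is
derivable in the formal system with empty set of hypotheses. -/
theorem completeness (ρ σ : RC) (hρ : WF ρ) (hσ : WF σ)
    (h : Compliant ρ σ) : Derives [] ρ σ := by
  by_contra hd
  obtain ⟨S, hSfin, hρS, hS⟩ := hρ.exists_finite_closed
  obtain ⟨T, hTfin, hσT, hT⟩ := hσ.exists_finite_closed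
  obtain ⟨ρ', σ', hr, h1, hb⟩ := Failing.of_not_derives (T := {s ∈ S ∪ T | WF s})
    ((hSfin.union hTfin).subset fun _ hs => hs.1)
    (fun s hs s' hs' => ⟨hs.1.imp (hS s · s' hs') (hT s · s' hs'), hs.2.succ hs'⟩)
    (fun _ hs => hs.2) [] ρ σ ⟨.inl hρS, hρ⟩ ⟨.inr hσT, hσ⟩ hd [] []
  refine h1 (h _ hr fun c' hc' => ?_)
  cases hc' with
  | fwd _ _ hf => exact hb _ hf
  | rbk _ _ _ _ _ _ _ _ _ _ hs => cases step_rb_iff.1 hs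
end

section
/- (Deadlock with unretractable client output.) Let ρ = rec x.(b̄.x ⊕ ā.c.x) and σ = rec x.(b.x + a.ē.x), where a, b, c, e are pairwise distinct names. Then ρ is not compliant with σ: there is a reduction ⟨[]⟩ρ ∥ ⟨[]⟩σ →* ⟨[]⟩∘ ∥ ⟨[]⟩(b.σ) to a stuck configuration whose client is different from 1. -/
/-- A retractable sum can only fire one of its own prefixes or roll back. -/
theorem Step.act_of_ext {γ δ : Hist} {p : Bool} {l : List (ℕ × RC)} {α : Act} {ρ : Option RC}
    (h : Step γ (some (.ext p l)) α δ ρ) :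
    (∃ a ∈ l.map Prod.fst, α = .act p a) ∨ α = .rb := by
  cases h with
  | ext _ _ l₁ l₂ a σ => exact .inl ⟨a, by simp, rfl⟩
  | rb => exact .inr rfl

/-- The placeholder `∘` can only roll back. -/
theorem Step.eq_rb_of_none {γ δ : Hist} {α : Act} {ρ : Option RC}
    (h : Step γ none α δ ρ) : α = .rb := by
  cases h
  rfl

/-- Retractable sums without a common name do not reduce forward. -/
theorem not_fRed_ext_ext {δ γ : Hist} {p q : Bool} {l m : List (ℕ × RC)}
    (hd : (l.map Prod.fst).Disjoint (m.map Prod.fst)) (d : Conf) :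
    ¬ FRed ⟨δ, some (.ext p l), γ, some (.ext q m)⟩ d := by
  rintro (⟨_, _, _, _, _, _, _, _, _, _, hl, hm⟩ | ⟨_, _, _, _, _, _, h⟩ | ⟨_, _, _, _, _, _, h⟩)
  · obtain ⟨x, hx, hxa⟩ | h := hl.act_of_ext
    · obtain ⟨y, hy, hya⟩ | h := hm.act_of_ext
      · cases hxa
        cases hya
        exact hd hx hy
      · cases h
    · cases h
  all_goals
    obtain ⟨_, _, h⟩ | h := h.act_of_ext <;> cases h

/-- A client `∘` with empty history deadlocks against any retractable sum. -/
theorem stuck_none_ext (γ : Hist) (p : Bool) (l : List (ℕ × RC)) :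
    Stuck ⟨[], none, γ, some (.ext p l)⟩ := by
  rintro c' (⟨_, _, h⟩ | ⟨_, _, _, _, _, _, _, _, _, _, h, _⟩)
  · rcases h with ⟨_, _, _, _, _, _, _, _, _, _, h, _⟩ | ⟨_, _, _, _, _, _, h⟩ |
      ⟨_, _, _, _, _, _, h⟩
    · cases h.eq_rb_of_none
    · cases h.eq_rb_of_none
    · obtain ⟨_, _, h⟩ | h := h.act_of_ext <;> cases h
  · cases h

/-- After choosing `a` internally and communicating on it, `c` and `ē` do not match, and the
forced rollback leaves the client without alternatives. -/
theorem reds_deadlock {a b c e : ℕ} (hce : c ≠ e) :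
    Reds ⟨[], some (.mu (.intSum [(b, .var 0), (a, .ext true [(c, .var 0)])])),
          [], some (.mu (.ext true [(b, .var 0), (a, .ext false [(e, .var 0)])]))⟩
         ⟨[], none,
          [], some (.ext true
                [(b, .mu (.ext true [(b, .var 0), (a, .ext false [(e, .var 0)])]))])⟩ := by
  set ρ : RC := .mu (.intSum [(b, .var 0), (a, .ext true [(c, .var 0)])]) with hρ
  set σ : RC := .mu (.ext true [(b, .var 0), (a, .ext false [(e, .var 0)])]) with hσ
  have choose_a : Step [] (some ρ) .tau [] (some (.intSum [(a, .ext true [(c, ρ)])])) := by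
    refine .mu _ _ _ _ _ ?_
    simp only [RC.unf, ← hρ]
    simp only [RC.subst, List.attach_cons, List.attach_nil, List.map_cons, List.map_nil, if_true]
    exact .intTau _ _ _ _ (by simp) (by simp)
  have server_a : Step [] (some σ) (.act true a) [some (.ext true [(b, σ)])]
      (some (.ext false [(e, σ)])) := by
    refine .mu _ _ _ _ _ ?_
    simp only [RC.unf, ← hσ]
    simp only [RC.subst, List.attach_cons, List.attach_nil, List.map_cons, List.map_nil, if_true]
    exact .ext _ _ [(b, σ)] [] _ _
  have client_a := Step.intOut [] a (.ext true [(c, ρ)])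
  refine .head (.fwd _ _ (.tauL _ _ _ _ _ _ choose_a)) <|
    .head (.fwd _ _ (.comm _ _ _ _ _ _ _ _ _ _ client_a server_a)) <|
    .single (.rbk _ _ _ _ _ _ _ _ (by simp) (not_fRed_ext_ext ?_) (.rb _ _ _) (.rb _ _ _))
  simpa using hce.symm

/-- Deadlock with unretractable client output: for
`ρ = rec x.(b̄.x ⊕ ā.c.x)` and `σ = rec x.(b.x + a.ē.x)` with pairwise
distinct names, ρ is not compliant with σ: the pair reduces to the stuck
configuration `⟨[]⟩∘ ∥ ⟨[]⟩b.σ`, whose client is different from `1`. -/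
theorem deadlock_unretractable (a b c e : ℕ)
    (hab : a ≠ b) (hac : a ≠ c) (hae : a ≠ e)
    (hbc : b ≠ c) (hbe : b ≠ e) (hce : c ≠ e) :
    ¬ Compliant (.mu (.intSum [(b, .var 0), (a, .ext true [(c, .var 0)])]))
                (.mu (.ext true [(b, .var 0), (a, .ext false [(e, .var 0)])])) ∧
    Reds ⟨[], some (.mu (.intSum [(b, .var 0), (a, .ext true [(c, .var 0)])])),
          [], some (.mu (.ext true [(b, .var 0), (a, .ext false [(e, .var 0)])]))⟩
         ⟨[], none,
          [], some (.ext true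
                [(b, .mu (.ext true [(b, .var 0), (a, .ext false [(e, .var 0)])]))])⟩ ∧
    Stuck ⟨[], none,
           [], some (.ext true
                [(b, .mu (.ext true [(b, .var 0), (a, .ext false [(e, .var 0)])]))])⟩ ∧
    (none : Option RC) ≠ some RC.one := by
  have hred := reds_deadlock (a := a) (b := b) hce
  have hstuck := stuck_none_ext []
  refine ⟨fun h => ?_, hred, hstuck _ _, by simp⟩
  cases h _ hred (hstuck _ _)
end
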